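/- arXiv:1610.05344 — 2 statements merged into one kernel-verified Lean document; each statement's English description precedes it below -/
import Mathlib

section
/- Let x ≥ 4 and let q* be a positive integer with q* ≤ Q ≤ x^{1/2}. Then Σ_{k ≤ Q/q*} 1/φ(k·q*) < (5E₀/4)·(log x)/φ(q*), where the sum is over positive integers k ≤ Q/q*. -/
open Real

noncomputable def E₀ : ℝ := ∏' p : Nat.Primes, (1 + 1 / ((p : ℝ) * ((p : ℝ) - 1)))

lemma aux_prod_le_E (P : Finset ℕ) (hP : ∀ p ∈ P, p.Prime) :
    ∏ p ∈ P, (1 + 1 / ((p : ℝ) * ((p : ℝ) - 1))) ≤ E₀ := by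
  classical
  have hpos : ∀ p : Nat.Primes, 0 ≤ 1 / ((p : ℝ) * ((p : ℝ) - 1)) := by
    intro p
    have : (2 : ℝ) ≤ (p : ℝ) := by exact_mod_cast p.2.two_le
    have h1 : 0 < (p : ℝ) - 1 := by linarith
    positivity
  have hs : Summable (fun p : Nat.Primes => 1 / ((p : ℝ) * ((p : ℝ) - 1))) := by
    have h2 : Summable (fun n : ℕ => 2 * (1 / (n : ℝ) ^ 2)) :=
      (Real.summable_one_div_nat_pow.mpr (by norm_num)).mul_left 2
    have h3 := h2.comp_injective (i := fun p : Nat.Primes => (p : ℕ)) Subtype.val_injective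
    refine Summable.of_nonneg_of_le hpos ?_ h3
    intro p
    have : (2 : ℝ) ≤ (p : ℝ) := by exact_mod_cast p.2.two_le
    have h1 : 0 < (p : ℝ) - 1 := by linarith
    simp only [Function.comp]
    rw [mul_one_div, div_le_div_iff₀ (by positivity) (by positivity)]
    nlinarith
  have hm : Multipliable (fun p : Nat.Primes => 1 + 1 / ((p : ℝ) * ((p : ℝ) - 1))) :=
    Real.multipliable_one_add_of_summable hs
  have hp := hm.hasProd
  have key : ∀ S : Finset Nat.Primes,
      ∏ p ∈ S, (1 + 1 / ((p : ℝ) * ((p : ℝ) - 1))) ≤ E₀ := by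
    intro S
    refine ge_of_tendsto hp ?_
    rw [SummationFilter.unconditional_filter]
    filter_upwards [Filter.eventually_ge_atTop S] with T hT
    rw [← Finset.prod_sdiff hT]
    refine le_mul_of_one_le_left (Finset.prod_nonneg fun p _ => by linarith [hpos p]) ?_
    exact Finset.one_le_prod fun p _ => by linarith [hpos p]
  have h := key (P.subtype Nat.Prime)
  have h' := Finset.prod_subtype_of_mem
    (fun p : ℕ => (1 + 1 / ((p : ℝ) * ((p : ℝ) - 1)))) hP
  exact h'.symm.le.trans h

lemma aux_sum_dvd (K D : ℕ) (hD : 0 < D) :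
    ∑ k ∈ (Finset.Icc 1 K).filter (fun k => D ∣ k), (1 : ℝ) / k ≤
      1 / D * ∑ k ∈ Finset.Icc 1 K, (1 : ℝ) / k := by
  classical
  have hsub : (Finset.Icc 1 K).filter (fun k => D ∣ k) ⊆
      (Finset.Icc 1 K).image (fun m => D * m) := by
    intro k hk
    simp only [Finset.mem_filter, Finset.mem_Icc, Finset.mem_image] at hk ⊢
    obtain ⟨⟨h1, h2⟩, m, rfl⟩ := hk
    refine ⟨m, ⟨?_, ?_⟩, rfl⟩
    · exact Nat.pos_of_mul_pos_left h1
    · nlinarith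
  refine (Finset.sum_le_sum_of_subset_of_nonneg hsub (fun _ _ _ => by positivity)).trans ?_
  rw [Finset.sum_image (fun a _ b _ h => Nat.eq_of_mul_eq_mul_left hD h), Finset.mul_sum]
  refine Finset.sum_le_sum fun m _ => ?_
  push_cast
  rw [one_div_mul_one_div]

lemma aux_totient (k : ℕ) (hk : 0 < k) :
    (1 : ℝ) / k.totient = 1 / k * ∏ p ∈ k.primeFactors, (1 + 1 / ((p : ℝ) - 1)) := by
  have h := Nat.totient_eq_mul_prod_factors k
  have h' : (k.totient : ℝ) = k * ∏ p ∈ k.primeFactors, (1 - (p : ℝ)⁻¹) := by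
    have h2 := congrArg (fun q : ℚ => (q : ℝ)) h
    push_cast at h2
    exact h2
  rw [h', ← one_div_mul_one_div]
  congr 1
  rw [one_div, ← Finset.prod_inv_distrib]
  refine Finset.prod_congr rfl fun p hp => ?_
  have : (2 : ℝ) ≤ (p : ℝ) := by exact_mod_cast (Nat.prime_of_mem_primeFactors hp).two_le
  have h1 : (p : ℝ) - 1 ≠ 0 := by linarith
  have h2 : (p : ℝ) ≠ 0 := by linarith
  field_simp
  ring

lemma aux_main (K : ℕ) :
    ∑ k ∈ Finset.Icc 1 K, (1 : ℝ) / k.totient ≤ E₀ * ∑ k ∈ Finset.Icc 1 K, (1 : ℝ) / k := by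
  classical
  set P := (Finset.Icc 1 K).filter Nat.Prime with hPdef
  have hP : ∀ p ∈ P, p.Prime := fun p hp => (Finset.mem_filter.mp hp).2
  have hw : ∀ s ∈ P.powerset, 0 ≤ ∏ p ∈ s, 1 / ((p : ℝ) - 1) := by
    intro s hs
    refine Finset.prod_nonneg fun p hp => ?_
    have : (2 : ℝ) ≤ (p : ℝ) := by
      exact_mod_cast (hP p (Finset.mem_powerset.mp hs hp)).two_le
    have h1 : 0 < (p : ℝ) - 1 := by linarith
    positivity
  calc ∑ k ∈ Finset.Icc 1 K, (1 : ℝ) / k.totient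
      ≤ ∑ k ∈ Finset.Icc 1 K, ∑ s ∈ P.powerset,
          if (∏ p ∈ s, p) ∣ k then (∏ p ∈ s, 1 / ((p : ℝ) - 1)) * (1 / (k : ℝ)) else 0 := by
        refine Finset.sum_le_sum fun k hk => ?_
        rw [Finset.mem_Icc] at hk
        rw [aux_totient k hk.1, Finset.prod_one_add, Finset.mul_sum, ← Finset.sum_filter]
        have hsub : k.primeFactors.powerset ⊆ P.powerset.filter (fun s => (∏ p ∈ s, p) ∣ k) := by
          intro s hs
          rw [Finset.mem_powerset] at hs
          rw [Finset.mem_filter, Finset.mem_powerset]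
          refine ⟨?_, Finset.prod_primes_dvd k ?_ ?_⟩
          · intro p hp
            have := hs hp
            have h1 := Nat.prime_of_mem_primeFactors this
            have h2 := Nat.le_of_dvd hk.1 (Nat.dvd_of_mem_primeFactors this)
            simp only [hPdef, Finset.mem_filter, Finset.mem_Icc]
            exact ⟨⟨h1.pos, h2.trans hk.2⟩, h1⟩
          · intro p hp; exact (Nat.prime_of_mem_primeFactors (hs hp)).prime
          · intro p hp; exact Nat.dvd_of_mem_primeFactors (hs hp)
        refine le_trans (le_of_eq ?_) (Finset.sum_le_sum_of_subset_of_nonneg hsub ?_)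
        · exact Finset.sum_congr rfl fun s _ => mul_comm _ _
        · intro s hs _
          exact mul_nonneg (hw s (Finset.mem_filter.mp hs).1) (by positivity)
    _ = ∑ s ∈ P.powerset, (∏ p ∈ s, 1 / ((p : ℝ) - 1)) *
          ∑ k ∈ (Finset.Icc 1 K).filter (fun k => (∏ p ∈ s, p) ∣ k), (1 : ℝ) / k := by
        rw [Finset.sum_comm]
        refine Finset.sum_congr rfl fun s _ => ?_
        rw [← Finset.sum_filter, Finset.mul_sum]
    _ ≤ ∑ s ∈ P.powerset, (∏ p ∈ s, 1 / ((p : ℝ) - 1)) *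
          (1 / ((∏ p ∈ s, p : ℕ) : ℝ) * ∑ k ∈ Finset.Icc 1 K, (1 : ℝ) / k) := by
        refine Finset.sum_le_sum fun s hs => mul_le_mul_of_nonneg_left (aux_sum_dvd K _ ?_) (hw s hs)
        exact Finset.prod_pos fun p hp => (hP p (Finset.mem_powerset.mp hs hp)).pos
    _ = (∏ p ∈ P, (1 + 1 / ((p : ℝ) * ((p : ℝ) - 1)))) * ∑ k ∈ Finset.Icc 1 K, (1 : ℝ) / k := by
        rw [Finset.prod_one_add, Finset.sum_mul]
        refine Finset.sum_congr rfl fun s _ => ?_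
        rw [← mul_assoc]
        congr 1
        push_cast
        rw [one_div, ← Finset.prod_inv_distrib, ← Finset.prod_mul_distrib]
        refine Finset.prod_congr rfl fun p _ => ?_
        rw [one_div, one_div, mul_inv, mul_comm]
    _ ≤ _ := mul_le_mul_of_nonneg_right (aux_prod_le_E P hP)
        (Finset.sum_nonneg fun _ _ => by positivity)

theorem sum_one_div_totient_mul_lt (x Q : ℝ) (hx : 4 ≤ x) (qstar : ℕ) (hqstar : 0 < qstar)
    (hqQ : (qstar : ℝ) ≤ Q) (hQx : Q ≤ x ^ ((1 : ℝ) / 2)) :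
    ∑ k ∈ Finset.Icc 1 ⌊Q / (qstar : ℝ)⌋₊, (1 : ℝ) / ((k * qstar).totient : ℝ) <
      5 * E₀ / 4 * Real.log x / (qstar.totient : ℝ) := by
  have hq1 : (1 : ℝ) ≤ qstar := by exact_mod_cast hqstar
  have hq0 : (0 : ℝ) < qstar := by linarith
  have hφ : (0 : ℝ) < qstar.totient := by exact_mod_cast Nat.totient_pos.mpr hqstar
  have hE : 0 < E₀ := by
    have := aux_prod_le_E ∅ (by simp)
    simp at this
    linarith
  set K := ⌊Q / (qstar : ℝ)⌋₊ with hK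
  have hK1 : 1 ≤ K := by
    rw [hK, Nat.one_le_floor_iff, le_div_iff₀ hq0]; linarith
  have hKQ : (K : ℝ) ≤ x ^ ((1 : ℝ) / 2) := by
    have h1 : (K : ℝ) ≤ Q / qstar := Nat.floor_le (by apply div_nonneg <;> linarith)
    have h2 : Q / qstar ≤ Q := div_le_self (by linarith) hq1
    linarith
  have hK0 : (0 : ℝ) < K := by exact_mod_cast hK1
  have hlogK : Real.log K ≤ 1 / 2 * Real.log x := by
    rw [← Real.log_rpow (by linarith)]
    exact Real.log_le_log hK0 hKQ
  have hlogx : 4 / 3 < Real.log x := by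
    have h1 : Real.log 4 ≤ Real.log x := Real.log_le_log (by norm_num) hx
    have h2 : Real.log 4 = 2 * Real.log 2 := by
      rw [show (4 : ℝ) = 2 ^ 2 by norm_num, Real.log_pow]; norm_num
    linarith [Real.log_two_gt_d9]
  have hH : ∑ k ∈ Finset.Icc 1 K, (1 : ℝ) / k ≤ 1 + Real.log K := by
    have := harmonic_le_one_add_log K
    rw [harmonic_eq_sum_Icc] at this
    push_cast at this
    simpa only [one_div] using this
  have hmain := aux_main K
  have hlt : ∑ k ∈ Finset.Icc 1 K, (1 : ℝ) / k.totient < 5 * E₀ / 4 * Real.log x := by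
    have : E₀ * ∑ k ∈ Finset.Icc 1 K, (1 : ℝ) / k < E₀ * (5 / 4 * Real.log x) :=
      mul_lt_mul_of_pos_left (by linarith) hE
    linarith
  refine lt_of_le_of_lt ?_ (div_lt_div_of_pos_right hlt hφ)
  rw [Finset.sum_div]
  refine Finset.sum_le_sum fun k hk => ?_
  rw [Finset.mem_Icc] at hk
  have hk0 : (0 : ℝ) < k.totient := by exact_mod_cast Nat.totient_pos.mpr hk.1
  rw [div_div]
  refine one_div_le_one_div_of_le (by positivity) ?_
  exact_mod_cast Nat.totient_super_multiplicative k qstar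
end

section
/- Let q ≥ 1 be an integer and a an integer with gcd(a,q) = 1. Then for every real y ≥ 2, |π₁(y;q,a) − π₁(y)/φ(q)| ≤ (1/log 2)·|ψ(y;q,a) − ψ(y)/φ(q)| + (1/log 2 − 1/log y)·max_{2 ≤ t ≤ y} |ψ(t;q,a) − ψ(t)/φ(q)|. -/
open Real ArithmeticFunction

open scoped Classical

noncomputable def psi (x : ℝ) : ℝ := ∑ n ∈ Finset.Icc 1 ⌊x⌋₊, Λ n

/-- `ψ(y; q, a) = ∑_{n ≤ y, n ≡ a (mod q)} Λ(n)`. -/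
noncomputable def psiMod (y : ℝ) (q a : ℕ) : ℝ :=
  ∑ n ∈ (Finset.Icc 1 ⌊y⌋₊).filter (fun n : ℕ => (n : ZMod q) = (a : ZMod q)), Λ n

/-- `π₁(y) = ∑_{2 ≤ n ≤ y} Λ(n) / log n`. -/
noncomputable def piOne (y : ℝ) : ℝ :=
  ∑ n ∈ Finset.Icc 2 ⌊y⌋₊, Λ n / Real.log n

/-- `π₁(y; q, a) = ∑_{2 ≤ n ≤ y, n ≡ a (mod q)} Λ(n) / log n`. -/
noncomputable def piOneMod (y : ℝ) (q a : ℕ) : ℝ :=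
  ∑ n ∈ (Finset.Icc 2 ⌊y⌋₊).filter (fun n : ℕ => (n : ZMod q) = (a : ZMod q)),
    Λ n / Real.log n

lemma abel_aux (c : ℕ → ℝ) (h1 : c 1 = 0) (M : ℝ) (N : ℕ) (hN : 2 ≤ N)
    (hM : ∀ n, 2 ≤ n → n ≤ N → |∑ k ∈ Finset.Icc 1 n, c k| ≤ M) :
    |∑ k ∈ Finset.Icc 2 N, c k / Real.log k - (∑ k ∈ Finset.Icc 1 N, c k) / Real.log N| ≤
      M * (1 / Real.log 2 - 1 / Real.log N) := by
  induction N, hN using Nat.le_induction with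
  | base =>
    have : Finset.Icc 1 2 = {1, 2} := by decide
    simp [this, h1]
  | succ N hN ih =>
    have ih' := ih (fun n h2 hn => hM n h2 (by omega))
    have hS := hM N hN (by omega)
    rw [Finset.sum_Icc_succ_top (by omega), Finset.sum_Icc_succ_top (by omega)]
    set T := ∑ k ∈ Finset.Icc 2 N, c k / Real.log k
    set S := ∑ k ∈ Finset.Icc 1 N, c k
    have hN' : (2 : ℝ) ≤ N := by exact_mod_cast hN
    have hlog : 0 < Real.log N := Real.log_pos (by linarith)
    have hle : Real.log N ≤ Real.log ((N + 1 : ℕ) : ℝ) :=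
      Real.log_le_log (by linarith) (by push_cast; linarith)
    have hd : 0 ≤ 1 / Real.log N - 1 / Real.log ((N + 1 : ℕ) : ℝ) :=
      sub_nonneg.2 (one_div_le_one_div_of_le hlog hle)
    have e : T + c (N + 1) / Real.log ((N + 1 : ℕ) : ℝ)
        - (S + c (N + 1)) / Real.log ((N + 1 : ℕ) : ℝ) =
        (T - S / Real.log N) + S * (1 / Real.log N - 1 / Real.log ((N + 1 : ℕ) : ℝ)) := by
      ring
    rw [e]
    refine (abs_add_le _ _).trans ?_
    rw [abs_mul, abs_of_nonneg hd]
    have := mul_le_mul_of_nonneg_right hS hd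
    linarith

lemma psi_diff (q a : ℕ) (t : ℝ) : psiMod t q a - psi t / (q.totient : ℝ) =
    ∑ n ∈ Finset.Icc 1 ⌊t⌋₊,
      ((if (n : ZMod q) = (a : ZMod q) then Λ n else 0) - Λ n / (q.totient : ℝ)) := by
  rw [psiMod, psi, Finset.sum_sub_distrib, Finset.sum_filter, Finset.sum_div]

lemma pi_diff (q a : ℕ) (t : ℝ) : piOneMod t q a - piOne t / (q.totient : ℝ) =
    ∑ n ∈ Finset.Icc 2 ⌊t⌋₊,
      ((if (n : ZMod q) = (a : ZMod q) then Λ n else 0) - Λ n / (q.totient : ℝ)) / Real.log n := by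
  rw [piOneMod, piOne, Finset.sum_filter, Finset.sum_div, ← Finset.sum_sub_distrib]
  refine Finset.sum_congr rfl fun n _ => ?_
  split_ifs <;> ring

theorem piOneMod_partial_summation_bound (q : ℕ) (hq : 1 ≤ q) (a : ℕ) (ha : Nat.Coprime a q)
    (y : ℝ) (hy : 2 ≤ y) :
    |piOneMod y q a - piOne y / (q.totient : ℝ)| ≤
      (1 / Real.log 2) * |psiMod y q a - psi y / (q.totient : ℝ)| +
        (1 / Real.log 2 - 1 / Real.log y) *
          ⨆ t ∈ Set.Icc (2 : ℝ) y, |psiMod t q a - psi t / (q.totient : ℝ)| := by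
  simp only [psi_diff, pi_diff]
  set c : ℕ → ℝ := fun n =>
    (if (n : ZMod q) = (a : ZMod q) then Λ n else 0) - Λ n / (q.totient : ℝ) with hc
  have h1 : c 1 = 0 := by simp [hc]
  change |∑ n ∈ Finset.Icc 2 ⌊y⌋₊, c n / Real.log n| ≤
    1 / Real.log 2 * |∑ n ∈ Finset.Icc 1 ⌊y⌋₊, c n| + (1 / Real.log 2 - 1 / Real.log y) *
      ⨆ t ∈ Set.Icc (2 : ℝ) y, |∑ n ∈ Finset.Icc 1 ⌊t⌋₊, c n|
  set M := ⨆ t ∈ Set.Icc (2 : ℝ) y, |∑ n ∈ Finset.Icc 1 ⌊t⌋₊, c n| with hMdef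
  have hbdd : BddAbove (Set.range fun t : ℝ =>
      ⨆ (_ : t ∈ Set.Icc (2 : ℝ) y), |∑ n ∈ Finset.Icc 1 ⌊t⌋₊, c n|) := by
    refine ⟨∑ n ∈ Finset.Icc 1 ⌊y⌋₊, |c n|, ?_⟩
    rintro _ ⟨t, rfl⟩
    refine Real.iSup_le (fun ht => ?_) (Finset.sum_nonneg fun _ _ => abs_nonneg _)
    refine (Finset.abs_sum_le_sum_abs _ _).trans ?_
    exact Finset.sum_le_sum_of_subset_of_nonneg
      (Finset.Icc_subset_Icc_right (Nat.floor_mono ht.2)) fun _ _ _ => abs_nonneg _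
  have hy0 : 0 ≤ y := by linarith
  have hN : 2 ≤ ⌊y⌋₊ := Nat.le_floor (by exact_mod_cast hy)
  have hNy : (⌊y⌋₊ : ℝ) ≤ y := Nat.floor_le hy0
  have hM : ∀ n, 2 ≤ n → n ≤ ⌊y⌋₊ → |∑ k ∈ Finset.Icc 1 n, c k| ≤ M := by
    intro n h2 hn
    have hmem : (n : ℝ) ∈ Set.Icc (2 : ℝ) y :=
      ⟨by exact_mod_cast h2, (Nat.cast_le.2 hn).trans hNy⟩
    have := le_ciSup hbdd (n : ℝ)
    simp only [ciSup_pos hmem, Nat.floor_natCast] at this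
    exact this
  have hM0 : 0 ≤ M := (abs_nonneg _).trans (hM _ hN le_rfl)
  have key := abel_aux c h1 M _ hN hM
  have hN2 : (2 : ℝ) ≤ (⌊y⌋₊ : ℝ) := by exact_mod_cast hN
  have hl2 : 0 < Real.log 2 := Real.log_pos (by norm_num)
  have hlN : Real.log 2 ≤ Real.log (⌊y⌋₊ : ℝ) := Real.log_le_log (by norm_num) hN2
  have hly : Real.log (⌊y⌋₊ : ℝ) ≤ Real.log y := Real.log_le_log (by linarith) hNy
  have i1 := one_div_le_one_div_of_le hl2 hlN
  have i2 := one_div_le_one_div_of_le (hl2.trans_le hlN) hly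
  set T := ∑ n ∈ Finset.Icc 2 ⌊y⌋₊, c n / Real.log n
  set S := ∑ n ∈ Finset.Icc 1 ⌊y⌋₊, c n
  have e : T = S / Real.log (⌊y⌋₊ : ℝ) + (T - S / Real.log (⌊y⌋₊ : ℝ)) := by ring
  have hS : |S / Real.log (⌊y⌋₊ : ℝ)| ≤ 1 / Real.log 2 * |S| := by
    rw [abs_div, abs_of_pos (hl2.trans_le hlN), div_eq_mul_one_div, mul_comm]
    exact mul_le_mul_of_nonneg_right i1 (abs_nonneg _)
  have hfin : M * (1 / Real.log 2 - 1 / Real.log (⌊y⌋₊ : ℝ)) ≤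
      (1 / Real.log 2 - 1 / Real.log y) * M := by
    rw [mul_comm]
    exact mul_le_mul_of_nonneg_right (by linarith) hM0
  have habs := abs_add_le (S / Real.log (⌊y⌋₊ : ℝ)) (T - S / Real.log (⌊y⌋₊ : ℝ))
  rw [← e] at habs
  linarith
end
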